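/- arXiv:2205.01664 — 4 statements merged into one kernel-verified Lean document; each statement's English description precedes it below -/
import Mathlib

section
/- For a prime p, any integer k with 1 ≤ k ≤ p−1, and any m with 0 ≤ m ≤ p−1, the number of k-element subsets A of {0, 1, ..., p−1} whose element sum is congruent to m modulo p equals (1/p)·C(p, k); equivalently, p times the cardinality of { A ⊆ {0,...,p−1} : |A| = k and ΣA ≡ m (mod p) } equals the binomial coefficient C(p, k). -/
/-- Translating subsets of `ZMod p` by `t` shifts the sum of a `k`-element subset by `k * t`. -/
theorem card_powersetCard_filter_sum_add (p k : ℕ) [NeZero p] (c t : ZMod p) :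
    (((Finset.univ : Finset (ZMod p)).powersetCard k).filter
        (fun A => ∑ i ∈ A, i = c + k * t)).card =
      (((Finset.univ : Finset (ZMod p)).powersetCard k).filter
        (fun A => ∑ i ∈ A, i = c)).card := by
  have h : (Finset.univ : Finset (ZMod p)).powersetCard k =
      ((Finset.univ : Finset (ZMod p)).powersetCard k).map
        (Finset.mapEmbedding (Equiv.addRight t).toEmbedding).toEmbedding := by
    rw [← Finset.powersetCard_map, Finset.map_univ_equiv]
  conv_lhs => rw [h]
  rw [Finset.filter_map, Finset.card_map]
  congr 1
  refine Finset.filter_congr fun A hA => ?_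
  obtain ⟨-, hA⟩ := Finset.mem_powersetCard.1 hA
  simp [Finset.sum_add_distrib, hA]

/-- The sums of the `k`-element subsets of `ZMod p` are equidistributed when `0 < k < p`. -/
theorem mul_card_powersetCard_filter_sum_eq (p k : ℕ) [Fact p.Prime] (hk : 0 < k) (hkp : k < p)
    (c : ZMod p) :
    p * (((Finset.univ : Finset (ZMod p)).powersetCard k).filter
        (fun A => ∑ i ∈ A, i = c)).card = p.choose k := by
  have hk0 : (k : ZMod p) ≠ 0 := fun h =>
    Nat.not_dvd_of_pos_of_lt hk hkp ((ZMod.natCast_eq_zero_iff k p).1 h)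
  have hconst (d : ZMod p) :
      (((Finset.univ : Finset (ZMod p)).powersetCard k).filter
        (fun A => ∑ i ∈ A, i = d)).card =
      (((Finset.univ : Finset (ZMod p)).powersetCard k).filter
        (fun A => ∑ i ∈ A, i = c)).card := by
    rw [← card_powersetCard_filter_sum_add p k c ((d - c) / k), mul_div_cancel₀ _ hk0,
      add_sub_cancel]
  have hsum := Finset.card_eq_sum_card_fiberwise
    (s := (Finset.univ : Finset (ZMod p)).powersetCard k) (t := Finset.univ)
    (f := fun A => ∑ i ∈ A, i) (fun _ _ => Finset.mem_coe.2 (Finset.mem_univ _))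
  simpa [hconst, ZMod.card] using hsum.symm

/-- For a prime `p`, `1 ≤ k ≤ p - 1` and `0 ≤ m ≤ p - 1`, the number of `k`-element
subsets of `{0, ..., p-1}` whose element sum is congruent to `m` mod `p` is
`(1/p) * C(p, k)`, stated as `p * card = C(p, k)`. -/
theorem stmt_0 (p k m : ℕ) (hp : p.Prime) (hk1 : 1 ≤ k) (hk2 : k ≤ p - 1)
    (hm : m ≤ p - 1) :
    p * (((Finset.range p).powersetCard k).filter
        (fun A => (∑ i ∈ A, i) % p = m)).card = Nat.choose p k := by
  have : Fact p.Prime := ⟨hp⟩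
  have hpos := hp.pos
  rw [← mul_card_powersetCard_filter_sum_eq p k hk1 (by omega) (m : ZMod p)]
  congr 1
  have hrange : Finset.range p =
      (Finset.univ : Finset (ZMod p)).map ⟨ZMod.val, ZMod.val_injective p⟩ := by
    ext a
    simp only [Finset.mem_range, Finset.mem_map, Finset.mem_univ, true_and,
      Function.Embedding.coeFn_mk]
    exact ⟨fun h => ⟨a, ZMod.val_cast_of_lt h⟩, fun ⟨x, hx⟩ => hx ▸ ZMod.val_lt x⟩
  rw [hrange, Finset.powersetCard_map, Finset.filter_map, Finset.card_map]
  congr 1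
  refine Finset.filter_congr fun A _ => ?_
  have hcast : ((∑ i ∈ A, i.val : ℕ) : ZMod p) = ∑ i ∈ A, i := by simp
  rw [← hcast, ZMod.natCast_eq_natCast_iff', Nat.mod_eq_of_lt (show m < p by omega)]
  simp
end

section
/- Let p be a prime, a a real number with 0 < a < 1, and b = 1 − a. Then for every m with 0 ≤ m ≤ p−1, the sum of a^{N_head(x)} · b^{p − N_head(x)} over all x ∈ {H,T}^p that are nonconstant and satisfy S_head(x) ≡ m (mod p) equals (1 − a^p − b^p)/p. -/
/-- Translating a proper nonempty subset `s` of `ZMod p` by `d / #s` shifts its sum by `d`. -/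
lemma ZMod.sum_map_addRight_div_card {p : ℕ} [Fact p.Prime] {s : Finset (ZMod p)}
    (hs : s.Nonempty) (hs' : s ≠ Finset.univ) (d : ZMod p) :
    ∑ i ∈ s.map (addRightEmbedding (d / s.card)), i = ∑ i ∈ s, i + d := by
  have hlt : s.card < p := by
    simpa [ZMod.card] using (Finset.card_lt_iff_ne_univ s).2 hs'
  have h0 : (s.card : ZMod p) ≠ 0 := by
    rw [Ne, ZMod.natCast_eq_zero_iff]
    exact Nat.not_dvd_of_pos_of_lt hs.card_pos hlt
  simp [Finset.sum_add_distrib, mul_div_cancel₀ _ h0]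

/-- The total weight, by cardinality, of the proper nonempty subsets of `ZMod p` with sum `t`
does not depend on `t`. -/
lemma ZMod.sum_proper_subsets_add {p : ℕ} [Fact p.Prime] (f : ℕ → ℝ) (t d : ZMod p) :
    ∑ s : Finset (ZMod p) with (s.Nonempty ∧ s ≠ Finset.univ) ∧ ∑ i ∈ s, i = t, f s.card =
      ∑ s : Finset (ZMod p) with (s.Nonempty ∧ s ≠ Finset.univ) ∧ ∑ i ∈ s, i = t + d,
        f s.card := by
  have huniv (s : Finset (ZMod p)) (c : ZMod p) (hs : s ≠ Finset.univ) :
      s.map (addRightEmbedding c) ≠ Finset.univ := by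
    rwa [Ne, ← Finset.card_eq_iff_eq_univ, Finset.card_map, Finset.card_eq_iff_eq_univ]
  have hinv (s : Finset (ZMod p)) (c : ZMod p) :
      (s.map (addRightEmbedding c)).map (addRightEmbedding (-c)) = s := by
    ext; simp
  refine Finset.sum_nbij' (fun s => s.map (addRightEmbedding (d / s.card)))
    (fun s => s.map (addRightEmbedding (-d / s.card))) ?_ ?_ ?_ ?_ ?_
  · intro s hs
    obtain ⟨⟨h1, h2⟩, h3⟩ := (Finset.mem_filter.1 hs).2
    refine Finset.mem_filter.2 ⟨Finset.mem_univ _, ⟨h1.map, huniv s _ h2⟩, ?_⟩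
    rw [ZMod.sum_map_addRight_div_card h1 h2, h3]
  · intro s hs
    obtain ⟨⟨h1, h2⟩, h3⟩ := (Finset.mem_filter.1 hs).2
    refine Finset.mem_filter.2 ⟨Finset.mem_univ _, ⟨h1.map, huniv s _ h2⟩, ?_⟩
    rw [ZMod.sum_map_addRight_div_card h1 h2, h3, add_neg_cancel_right]
  · intro s _
    simpa [neg_div] using hinv s (d / s.card)
  · intro s _
    simpa [neg_div] using hinv s (-d / s.card)
  · intro s _
    simp

/-- The proper nonempty subsets of `ZMod p` are equidistributed over the values of their sum. -/
lemma ZMod.card_mul_sum_proper_subsets {p : ℕ} [Fact p.Prime] (f : ℕ → ℝ) (t : ZMod p) :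
    p * ∑ s : Finset (ZMod p) with (s.Nonempty ∧ s ≠ Finset.univ) ∧ ∑ i ∈ s, i = t, f s.card =
      (∑ s : Finset (ZMod p), f s.card) - f p - f 0 := by
  have hconst (u : ZMod p) := ZMod.sum_proper_subsets_add f t (u - t)
  simp only [add_sub_cancel] at hconst
  have hfib := Finset.sum_fiberwise
    (Finset.univ.filter fun s : Finset (ZMod p) => s.Nonempty ∧ s ≠ Finset.univ)
    (fun s => ∑ i ∈ s, i) (fun s => f s.card)
  simp only [Finset.filter_filter, ← hconst, Finset.sum_const, Finset.card_univ, ZMod.card,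
    nsmul_eq_mul] at hfib
  rw [hfib]
  have hset : (Finset.univ.filter fun s : Finset (ZMod p) => s.Nonempty ∧ s ≠ Finset.univ) =
      (Finset.univ.erase Finset.univ).erase ∅ := by
    ext s; simp [Finset.nonempty_iff_ne_empty]
  have hne : (∅ : Finset (ZMod p)) ∈ (Finset.univ : Finset (Finset (ZMod p))).erase Finset.univ :=
    Finset.mem_erase.2 ⟨Finset.univ_nonempty.ne_empty.symm, Finset.mem_univ _⟩
  rw [hset, Finset.sum_erase_eq_sub hne, Finset.sum_erase_eq_sub (Finset.mem_univ _)]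
  simp [ZMod.card]


/-- For a prime `p`, `0 < a < 1`, `b = 1 - a` and `0 ≤ m ≤ p - 1`, the sum of
`a ^ N_head x * b ^ (p - N_head x)` over all nonconstant outcomes `x : Fin p → Bool`
(`true` = head) with `S_head x ≡ m (mod p)` equals `(1 - a^p - b^p) / p`. -/
theorem stmt_3 (p : ℕ) (hp : p.Prime) (a b : ℝ) (ha0 : 0 < a) (ha1 : a < 1)
    (hb : b = 1 - a) (m : ℕ) (hm : m ≤ p - 1) :
    ∑ x ∈ (Finset.univ : Finset (Fin p → Bool)).filter
        (fun x : Fin p → Bool => (x ≠ fun _ => true) ∧ (x ≠ fun _ => false) ∧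
          (∑ i ∈ Finset.univ.filter (fun i : Fin p => x i = true), (i : ℕ)) % p = m),
      a ^ (Finset.univ.filter (fun i : Fin p => x i = true)).card *
        b ^ (p - (Finset.univ.filter (fun i : Fin p => x i = true)).card)
    = (1 - a ^ p - b ^ p) / p := by
  subst hb
  have : Fact p.Prime := ⟨hp⟩
  have hm' : m < p := by have := hp.pos; omega
  have hp0 : (p : ℝ) ≠ 0 := by exact_mod_cast hp.ne_zero
  have key := ZMod.card_mul_sum_proper_subsets (fun k => a ^ k * (1 - a) ^ (p - k)) (m : ZMod p)
  have htotal := Fintype.sum_pow_mul_eq_add_pow (ZMod p) a (1 - a)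
  rw [ZMod.card, add_sub_cancel, one_pow] at htotal
  simp only [htotal, Nat.sub_self, pow_zero, mul_one, one_mul, Nat.sub_zero] at key
  rw [eq_div_iff hp0, mul_comm, ← key]
  congr 1
  let e : Fin p ≃ ZMod p :=
    { toFun := fun i => (i : ℕ)
      invFun := fun z => ⟨z.val, z.val_lt⟩
      left_inv := fun i => by simp [ZMod.val_cast_of_lt i.2]
      right_inv := fun z => by simp }
  let E : (Fin p → Bool) ≃ Finset (ZMod p) :=
    { toFun := fun x => (Finset.univ.filter fun i => x i = true).map e.toEmbedding
      invFun := fun s i => decide (e i ∈ s)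
      left_inv := fun x => by ext i; simp
      right_inv := fun s => by ext z; simp }
  refine Finset.sum_equiv E (fun x => ?_) fun x _ => by simp [E]
  have htrue : E (fun _ => true) = Finset.univ := by simp [E]
  have hfalse : E (fun _ => false) = ∅ := by simp [E]
  have hsum : ∑ z ∈ E x, z = ((∑ i with x i = true, (i : ℕ) : ℕ) : ZMod p) := by
    simp [E, e]
  rw [Finset.mem_filter_univ, Finset.mem_filter_univ, Finset.nonempty_iff_ne_empty, ← hfalse,
    ← htrue, E.injective.ne_iff, E.injective.ne_iff, hsum, ZMod.natCast_eq_natCast_iff',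
    Nat.mod_eq_of_lt hm']
  tauto
end

section
/- Let (E, ℰ) be a measurable space, ν a probability measure on E, and μ the infinite product over ℕ of ν, a probability measure on ℕ → E under which the coordinates ω(0), ω(1), ... are i.i.d. with law ν. Let G be a measurable subset of E with ν(G) > 0, and for ω : ℕ → E let τ(ω) be the least index i with ω(i) ∈ G. Then τ is finite μ-almost surely, and for every measurable A ⊆ G, μ{ ω : τ(ω) is finite and ω(τ(ω)) ∈ A } = ν(A)/ν(G). -/
open MeasureTheory

/-- The first hitting time of `G` by the coordinate sequence `ω`, taken in `ℕ∞`
(equal to `∞` if no coordinate lies in `G`). -/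
noncomputable def hitTime {E : Type*} (G : Set E) (ω : ℕ → E) : ℕ∞ :=
  ⨅ (i : ℕ) (_ : ω i ∈ G), (i : ℕ∞)

theorem hitTime_eq_top_iff {E : Type*} {G : Set E} {ω : ℕ → E} :
    hitTime G ω = ⊤ ↔ ∀ i, ω i ∉ G := by
  simp [hitTime, iInf_eq_top]

theorem hitTime_eq_coe_iff {E : Type*} {G : Set E} {ω : ℕ → E} {n : ℕ} (hn : ω n ∈ G) :
    hitTime G ω = n ↔ ∀ i < n, ω i ∉ G := by
  constructor
  · intro h i hi hiG
    have hle : hitTime G ω ≤ i := iInf₂_le i hiG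
    rw [h, Nat.cast_le] at hle
    omega
  · intro h
    refine le_antisymm (iInf₂_le n hn) (le_iInf₂ fun i hi => ?_)
    rw [Nat.cast_le]
    by_contra! hlt
    exact h i hlt hi

/-- The set of sequences whose first visit to `G` is at time `n`, at a point of `A`. -/
def firstVisit {E : Type*} (G A : Set E) (n : ℕ) : Set (ℕ → E) :=
  {ω | ∀ i < n + 1, ω i ∈ if i < n then Gᶜ else A}

theorem mem_firstVisit {E : Type*} {G A : Set E} {n : ℕ} {ω : ℕ → E} :
    ω ∈ firstVisit G A n ↔ (∀ i < n, ω i ∉ G) ∧ ω n ∈ A := by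
  constructor
  · intro h
    refine ⟨fun i hi => ?_, by simpa using h n n.lt_succ_self⟩
    have hiG := h i (by omega)
    rwa [if_pos hi] at hiG
  · rintro ⟨h, hn⟩ i hi
    split_ifs with hlt
    · exact h i hlt
    · obtain rfl : i = n := by omega
      exact hn

theorem setOf_hitTime_eq_iUnion_firstVisit {E : Type*} {G A : Set E} (hAG : A ⊆ G) :
    {ω : ℕ → E | ∃ i : ℕ, hitTime G ω = (i : ℕ∞) ∧ ω i ∈ A} = ⋃ n, firstVisit G A n := by
  ext ω
  simp only [Set.mem_ofPred_eq, Set.mem_iUnion, mem_firstVisit]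
  exact exists_congr fun n => and_congr_left fun hn => hitTime_eq_coe_iff (hAG hn)

theorem pairwise_disjoint_firstVisit {E : Type*} {G A : Set E} (hAG : A ⊆ G) :
    Pairwise (Function.onFun Disjoint (firstVisit G A)) := by
  intro m n hmn
  refine Set.disjoint_left.2 fun ω hm hn => ?_
  rw [mem_firstVisit] at hm hn
  rcases hmn.lt_or_gt with h | h
  · exact hn.1 m h (hAG hm.2)
  · exact hm.1 n h (hAG hn.2)

theorem measurableSet_firstVisit {E : Type*} [MeasurableSpace E] {G A : Set E}
    (hG : MeasurableSet G) (hA : MeasurableSet A) (n : ℕ) :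
    MeasurableSet (firstVisit G A n) := by
  have heq : firstVisit G A n
      = ⋂ i, ⋂ _ : i < n + 1, (fun ω : ℕ → E => ω i) ⁻¹' (if i < n then Gᶜ else A) := by
    ext ω
    simp only [firstVisit, Set.mem_ofPred_eq, Set.mem_iInter, Set.mem_preimage]
  rw [heq]
  refine .iInter fun i => .iInter fun _ => measurable_pi_apply i ?_
  split_ifs
  exacts [hG.compl, hA]

/-- Let `ν` be a probability measure on `E` and `μ` the infinite product over `ℕ` of
`ν` (characterized by its values on cylinder sets), so that the coordinates are i.i.d.
with law `ν`. If `G ⊆ E` is measurable with `ν G > 0` and `τ` is the first hitting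
time of `G`, then `τ` is finite `μ`-a.s., and for every measurable `A ⊆ G`,
`μ {ω | τ ω < ∞ ∧ ω (τ ω) ∈ A} = ν A / ν G`. -/
theorem stmt_10 {E : Type*} [MeasurableSpace E] (ν : Measure E)
    (hν : IsProbabilityMeasure ν) (μ : Measure (ℕ → E))
    (hμprob : IsProbabilityMeasure μ)
    (hμ : ∀ (n : ℕ) (s : ℕ → Set E), (∀ i, MeasurableSet (s i)) →
      μ {ω | ∀ i < n, ω i ∈ s i} = ∏ i ∈ Finset.range n, ν (s i))
    (G : Set E) (hG : MeasurableSet G) (hGpos : 0 < ν G) :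
    μ {ω : ℕ → E | hitTime G ω = ⊤} = 0 ∧
    ∀ A : Set E, MeasurableSet A → A ⊆ G →
      μ {ω : ℕ → E | ∃ i : ℕ, hitTime G ω = (i : ℕ∞) ∧ ω i ∈ A} = ν A / ν G := by
  have key : ∀ A : Set E, MeasurableSet A → A ⊆ G →
      μ {ω : ℕ → E | ∃ i : ℕ, hitTime G ω = (i : ℕ∞) ∧ ω i ∈ A} = ν A / ν G := by
    intro A hA hAG
    have hterm (n : ℕ) : μ (firstVisit G A n) = ν Gᶜ ^ n * ν A := by
      rw [firstVisit, hμ (n + 1) (fun i => if i < n then Gᶜ else A)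
        (fun i => by split_ifs; exacts [hG.compl, hA]), Finset.prod_range_succ,
        if_neg (lt_irrefl n), Finset.prod_congr rfl fun i hi =>
          by rw [if_pos (Finset.mem_range.1 hi)]]
      simp
    have hcompl : 1 - ν Gᶜ = ν G := by
      rw [← prob_compl_eq_one_sub hG.compl, compl_compl]
    rw [setOf_hitTime_eq_iUnion_firstVisit hAG,
      measure_iUnion (pairwise_disjoint_firstVisit hAG) (measurableSet_firstVisit hG hA)]
    simp_rw [hterm]
    rw [ENNReal.tsum_mul_right, ENNReal.tsum_geometric, hcompl, mul_comm, div_eq_mul_inv]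
  refine ⟨?_, key⟩
  have hone := key G hG subset_rfl
  rw [ENNReal.div_self hGpos.ne' (measure_ne_top ν G)] at hone
  have htop : {ω : ℕ → E | hitTime G ω = ⊤}
      = {ω : ℕ → E | ∃ i : ℕ, hitTime G ω = (i : ℕ∞) ∧ ω i ∈ G}ᶜ := by
    ext ω
    refine ⟨fun h => ?_, fun h => hitTime_eq_top_iff.2 fun i hi => h ?_⟩
    · rintro ⟨i, -, hi⟩
      exact hitTime_eq_top_iff.1 h i hi
    · classical
      have hex : ∃ i, ω i ∈ G := ⟨i, hi⟩
      exact ⟨Nat.find hex, (hitTime_eq_coe_iff (Nat.find_spec hex)).2 fun j => Nat.find_min hex,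
        Nat.find_spec hex⟩
  rw [htop, prob_compl_eq_zero_iff]
  · exact hone
  · rw [setOf_hitTime_eq_iUnion_firstVisit subset_rfl]
    exact .iUnion (measurableSet_firstVisit hG hG)
end

section
/- For a prime p and any m with 0 ≤ m ≤ p−1, the number of nonconstant outcomes x ∈ {H,T}^p with S_head(x) ≡ m (mod p) equals (2^p − 2)/p; equivalently, p times the cardinality of { x : Fin p → Bool : x nonconstant and S_head(x) ≡ m (mod p) } equals 2^p − 2. -/
open Finset in
/-- Translating a nonempty proper subset of `ZMod p` by a suitable constant turns its sum from `a`
into `b`. -/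
lemma card_proper_subsets_sum_eq_le (p : ℕ) [Fact p.Prime] (a b : ZMod p) :
    #{s : Finset (ZMod p) | (s ≠ ∅ ∧ s ≠ univ) ∧ ∑ i ∈ s, i = a} ≤
      #{s : Finset (ZMod p) | (s ≠ ∅ ∧ s ≠ univ) ∧ ∑ i ∈ s, i = b} := by
  have hp : p.Prime := Fact.out
  refine card_le_card_of_injOn
    (fun s ↦ s.map (addRightEmbedding ((b - a) / (#s : ZMod p)))) ?_ ?_
  · intro s hs
    simp only [coe_filter, mem_univ, true_and, Set.mem_ofPred_eq] at hs ⊢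
    obtain ⟨⟨hne, hnu⟩, rfl⟩ := hs
    have hcard : #s < p := by
      simpa [ZMod.card] using card_lt_card (ssubset_univ_iff.2 hnu)
    have hk : (#s : ZMod p) ≠ 0 := by
      rw [Ne, ZMod.natCast_eq_zero_iff]
      exact Nat.not_dvd_of_pos_of_lt (card_pos.2 (nonempty_iff_ne_empty.2 hne)) hcard
    refine ⟨⟨by simpa using hne, fun h ↦ ?_⟩, ?_⟩
    · have := congrArg card h
      rw [card_map, card_univ, ZMod.card] at this
      exact hcard.ne this
    · simp [sum_add_distrib, mul_div_cancel₀ _ hk]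
  · intro s _ t _ h
    have hst : #s = #t := by simpa using congrArg card h
    simp only [hst] at h
    exact map_injective _ h

open Finset in
/-- The sums of the nonempty proper subsets of `ZMod p` are equidistributed. -/
lemma mul_card_proper_subsets_sum_eq (p : ℕ) [Fact p.Prime] (a : ZMod p) :
    p * #{s : Finset (ZMod p) | (s ≠ ∅ ∧ s ≠ univ) ∧ ∑ i ∈ s, i = a} = 2 ^ p - 2 := by
  have htotal : #{s : Finset (ZMod p) | s ≠ ∅ ∧ s ≠ univ} = 2 ^ p - 2 := by
    have : ({s : Finset (ZMod p) | s ≠ ∅ ∧ s ≠ univ} : Finset (Finset (ZMod p))) =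
        univ \ {∅, univ} := by
      ext s
      simp
    rw [this, card_sdiff_of_subset (subset_univ _), card_pair univ_nonempty.ne_empty.symm]
    simp [ZMod.card]
  rw [← htotal, card_eq_sum_card_fiberwise (s := {s : Finset (ZMod p) | s ≠ ∅ ∧ s ≠ univ})
    (f := fun s ↦ ∑ i ∈ s, i) (t := univ) (by simp)]
  simp only [filter_filter]
  rw [sum_congr rfl fun b _ ↦ le_antisymm (card_proper_subsets_sum_eq_le p b a)
    (card_proper_subsets_sum_eq_le p a b)]
  simp [ZMod.card]

/-- For a prime `p` and `0 ≤ m ≤ p - 1`, the number of nonconstant outcomes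
`x : Fin p → Bool` (`true` = head) with `S_head x ≡ m (mod p)` equals `(2^p - 2)/p`,
stated as `p * card = 2^p - 2`. -/
theorem stmt_11 (p : ℕ) (hp : p.Prime) (m : ℕ) (hm : m ≤ p - 1) :
    p * ((Finset.univ : Finset (Fin p → Bool)).filter
        (fun x : Fin p → Bool => (x ≠ fun _ => true) ∧ (x ≠ fun _ => false) ∧
          (∑ i ∈ Finset.univ.filter (fun i : Fin p => x i = true), (i : ℕ)) % p = m)).card
      = 2 ^ p - 2 := by
  obtain ⟨n, rfl⟩ : ∃ n, p = n + 1 := ⟨p - 1, by have := hp.pos; omega⟩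
  have : Fact (n + 1).Prime := ⟨hp⟩
  rw [← mul_card_proper_subsets_sum_eq (n + 1) (m : ZMod (n + 1))]
  congr 1
  have hsum (s : Finset (Fin (n + 1))) : (∑ i ∈ s, (i : ℕ)) % (n + 1) = m ↔
      ∑ i ∈ (show Finset (ZMod (n + 1)) from s), i = (m : ZMod (n + 1)) := by
    have hcast : ((∑ i ∈ s, (i : ℕ) : ℕ) : ZMod (n + 1)) =
        ∑ i ∈ (show Finset (ZMod (n + 1)) from s), i := by
      rw [Nat.cast_sum]
      exact Finset.sum_congr rfl fun i _ ↦ ZMod.natCast_zmod_val (n := n + 1) i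
    rw [← hcast, ZMod.natCast_eq_natCast_iff', Nat.mod_eq_of_lt (show m < n + 1 by omega)]
  refine Finset.card_bij (fun (x : Fin (n + 1) → Bool) _ ↦
    (Finset.univ.filter fun i : Fin (n + 1) ↦ x i = true : Finset (Fin (n + 1)))) ?_ ?_ ?_
  · intro x hx
    replace hx := (Finset.mem_filter.1 hx).2
    refine Finset.mem_filter.2 ⟨Finset.mem_univ _, ⟨fun h ↦ hx.2.1 ?_, fun h ↦ hx.1 ?_⟩, (hsum _).1 hx.2.2⟩
    · funext i
      simpa using Finset.filter_eq_empty_iff.1 h (Finset.mem_univ i)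
    · funext i
      exact Finset.filter_eq_self.1 h i (Finset.mem_univ i)
  · intro x _ y _ h
    funext i
    rw [Bool.eq_iff_iff]
    exact Finset.filter_inj'.1 h (Finset.mem_univ i)
  · intro s hs
    replace hs := (Finset.mem_filter.1 hs).2
    have hfilter : (Finset.univ.filter fun i : Fin (n + 1) ↦
        decide (i ∈ (show Finset (Fin (n + 1)) from s)) = true) = s := by
      ext i
      simp
    refine ⟨fun i ↦ decide (i ∈ (show Finset (Fin (n + 1)) from s)), ?_, hfilter⟩
    refine Finset.mem_filter.2 ⟨Finset.mem_univ _, fun h ↦ hs.1.2 ?_, fun h ↦ hs.1.1 ?_, ?_⟩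
    · exact Finset.eq_univ_iff_forall.2 fun i ↦ of_decide_eq_true (congrFun h i)
    · exact Finset.eq_empty_iff_forall_notMem.2 fun i ↦ of_decide_eq_false (congrFun h i)
    · rw [hfilter]
      exact (hsum s).2 hs.2
end
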